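/- arXiv:1503.08570 — 8 statements merged into one kernel-verified Lean document; each statement's English description precedes it below -/
import Mathlib

section
/- There exist constants ζ₀ > 0, C > 0, and H₀ ∈ ℕ with the following property. Let H ≥ H₀ and l be natural numbers, let α ≥ 0.01 and 0 < ζ ≤ ζ₀ be reals, and let w_1, …, w_l be real weights with 0 ≤ w_i ≤ ζ for all i and ∑_{i=1}^l w_i = α·H. When the l balls are thrown independently and uniformly at random into the H bins, then with probability at least 1 − exp(−C·H), the number of bins j whose weight lies in the interval [α·(15/16), 2α] is at least (31/32)·H. -/
open scoped Classical

section

open Finset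

/-- For a centred vector `a` with entries in `[-2, 2]` and `0 ≤ t ≤ 1/2`, the exponential sum
`∑ exp (t * a j)` is sub-Gaussian in `t`. -/
lemma sum_exp_mul_le_of_sum_eq_zero {ι : Type*} [Fintype ι] (a : ι → ℝ) (h0 : ∑ j, a j = 0)
    (h2 : ∀ j, |a j| ≤ 2) {t : ℝ} (ht : 0 ≤ t) (ht' : t ≤ 1 / 2) :
    ∑ j, Real.exp (t * a j) ≤ Fintype.card ι * Real.exp (4 * t ^ 2) := by
  have hpt : ∀ j, Real.exp (t * a j) ≤ t * a j + Real.exp (4 * t ^ 2) := by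
    intro j
    have hle : |t * a j| ≤ 1 := by
      rw [abs_mul, abs_of_nonneg ht]
      nlinarith [h2 j, abs_nonneg (a j)]
    have hquad := (abs_le.1 (Real.abs_exp_sub_one_sub_id_le hle)).2
    have hsq : (a j) ^ 2 ≤ 4 := by
      rw [← sq_abs]
      nlinarith [h2 j, abs_nonneg (a j)]
    have hexp := Real.add_one_le_exp (4 * t ^ 2)
    nlinarith [mul_le_mul_of_nonneg_left hsq (sq_nonneg t)]
  calc ∑ j, Real.exp (t * a j) ≤ ∑ j, (t * a j + Real.exp (4 * t ^ 2)) :=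
        sum_le_sum fun j _ => hpt j
    _ = Fintype.card ι * Real.exp (4 * t ^ 2) := by
        rw [sum_add_distrib, ← mul_sum, h0]
        simp

/-- Moment generating function bound for a weighted sum of independent uniform samples of a
centred vector `a`. -/
lemma sum_exp_weighted_sum_le {H l : ℕ} (a : Fin H → ℝ) (h0 : ∑ j, a j = 0)
    (h2 : ∀ j, |a j| ≤ 2) (w : Fin l → ℝ) {r : ℝ} (hr : 0 ≤ r)
    (hw : ∀ i, 0 ≤ w i ∧ r * w i ≤ 1 / 2) :
    ∑ ω : Fin l → Fin H, Real.exp (r * ∑ i, w i * a (ω i)) ≤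
      (H : ℝ) ^ l * Real.exp (4 * r ^ 2 * ∑ i, w i ^ 2) := by
  have hprod : ∑ ω : Fin l → Fin H, Real.exp (r * ∑ i, w i * a (ω i)) =
      ∏ i, ∑ j, Real.exp (r * w i * a j) := by
    rw [prod_univ_sum, Fintype.piFinset_univ]
    refine sum_congr rfl fun ω _ => ?_
    rw [← Real.exp_sum, mul_sum]
    simp only [mul_assoc]
  rw [hprod]
  calc ∏ i, ∑ j, Real.exp (r * w i * a j)
      ≤ ∏ i : Fin l, ((H : ℝ) * Real.exp (4 * (r * w i) ^ 2)) := by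
        refine prod_le_prod (fun i _ => by positivity) fun i _ => ?_
        simpa using sum_exp_mul_le_of_sum_eq_zero a h0 h2 (mul_nonneg hr (hw i).1) (hw i).2
    _ = (H : ℝ) ^ l * Real.exp (4 * r ^ 2 * ∑ i, w i ^ 2) := by
        rw [prod_mul_distrib, ← Real.exp_sum, mul_sum]
        simp [mul_pow, mul_assoc]

/-- The sign encoded by a Boolean. -/
def boolSign (b : Bool) : ℝ := if b then 1 else -1

lemma abs_boolSign (b : Bool) : |boolSign b| = 1 := by
  cases b <;> simp [boolSign]

/-- A sign pattern with its mean subtracted. -/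
noncomputable def centredSign {H : ℕ} (s : Fin H → Bool) (j : Fin H) : ℝ :=
  boolSign (s j) - (∑ k, boolSign (s k)) / H

lemma sum_centredSign {H : ℕ} (hH : 0 < H) (s : Fin H → Bool) : ∑ j, centredSign s j = 0 := by
  have : (H : ℝ) ≠ 0 := by positivity
  simp only [centredSign, sum_sub_distrib, sum_const, card_univ, Fintype.card_fin, nsmul_eq_mul]
  field_simp
  ring

lemma abs_centredSign_le {H : ℕ} (hH : 0 < H) (s : Fin H → Bool) (j : Fin H) :
    |centredSign s j| ≤ 2 := by
  have hH' : (0 : ℝ) < H := by positivity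
  have hmean : |(∑ k, boolSign (s k)) / H| ≤ 1 := by
    rw [abs_div, abs_of_pos hH', div_le_one hH']
    refine (abs_sum_le_sum_abs _ _).trans ?_
    simp [abs_boolSign]
  have := abs_sub (boolSign (s j)) ((∑ k, boolSign (s k)) / H)
  rw [abs_boolSign] at this
  unfold centredSign
  linarith

/-- The total deviation of the bin weights from their mean is attained by a sign pattern. -/
lemma exists_sum_abs_eq_sum_centredSign {H l : ℕ} (hH : 0 < H) {α : ℝ} (w : Fin l → ℝ)
    (hsum : ∑ i, w i = α * H) (ω : Fin l → Fin H) :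
    ∃ s : Fin H → Bool, ∑ j, |(∑ i ∈ univ.filter (fun i => ω i = j), w i) - α| =
      ∑ i, w i * centredSign s (ω i) := by
  have hH' : (H : ℝ) ≠ 0 := by positivity
  set X : Fin H → ℝ := fun j => ∑ i ∈ univ.filter (fun i => ω i = j), w i with hX
  refine ⟨fun j => decide (0 ≤ X j - α), ?_⟩
  set s : Fin H → Bool := fun j => decide (0 ≤ X j - α) with hs
  have habs : ∀ j, |X j - α| = boolSign (s j) * X j - α * boolSign (s j) := by
    intro j
    by_cases h : 0 ≤ X j - α
    · simp only [hs, boolSign, h, abs_of_nonneg h]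
      simp
    · simp only [hs, boolSign, h, abs_of_neg (not_le.1 h)]
      simp
      ring
  have hfib : ∑ j, boolSign (s j) * X j = ∑ i, w i * boolSign (s (ω i)) := by
    rw [← sum_fiberwise univ ω]
    refine sum_congr rfl fun j _ => ?_
    rw [hX, mul_sum]
    refine sum_congr rfl fun i hi => ?_
    rw [(mem_filter.1 hi).2, mul_comm]
  change ∑ j, |X j - α| = _
  simp only [habs, centredSign, mul_sub, sum_sub_distrib]
  rw [hfib, ← mul_sum, ← sum_mul, hsum]
  field_simp

/-- Union bound over sign patterns: few outcomes have total deviation at least `α * H / 512`. -/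
lemma card_large_deviation_le {H l : ℕ} (hH : 0 < H) {α ζ : ℝ} (hα : 0.01 ≤ α) (hζ : 0 < ζ)
    (hζ' : ζ ≤ 1 / 10 ^ 9) (w : Fin l → ℝ) (hw : ∀ i, 0 ≤ w i ∧ w i ≤ ζ)
    (hsum : ∑ i, w i = α * H) :
    ((univ.filter fun ω : Fin l → Fin H => α * H / 512 ≤
        ∑ j, |(∑ i ∈ univ.filter (fun i => ω i = j), w i) - α|).card : ℝ) ≤
      (H : ℝ) ^ l * Real.exp (-1 * H) := by
  set B := univ.filter fun ω : Fin l → Fin H => α * H / 512 ≤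
        ∑ j, |(∑ i ∈ univ.filter (fun i => ω i = j), w i) - α|
  set r : ℝ := 1 / (4096 * ζ) with hr
  have hr0 : 0 < r := by positivity
  have hrζ : r * ζ = 1 / 4096 := by rw [hr]; field_simp
  have hH' : (0 : ℝ) < H := by positivity
  have hsq : ∑ i, w i ^ 2 ≤ ζ * (α * H) := by
    rw [← hsum, mul_sum]
    refine sum_le_sum fun i _ => ?_
    nlinarith [hw i]
  have hlower : (B.card : ℝ) * Real.exp (r * (α * H / 512)) ≤
      ∑ ω : Fin l → Fin H, ∑ s : Fin H → Bool,
        Real.exp (r * ∑ i, w i * centredSign s (ω i)) := by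
    rw [← nsmul_eq_mul, ← sum_const]
    refine (sum_le_sum fun ω hω => ?_).trans
      (sum_le_sum_of_subset_of_nonneg (subset_univ B) fun _ _ _ => by positivity)
    obtain ⟨s, hs⟩ := exists_sum_abs_eq_sum_centredSign hH w hsum ω
    have hω' := (mem_filter.1 hω).2
    rw [hs] at hω'
    refine le_trans (Real.exp_le_exp.2 (mul_le_mul_of_nonneg_left hω' hr0.le)) ?_
    exact single_le_sum (f := fun s => Real.exp (r * ∑ i, w i * centredSign s (ω i)))
      (fun _ _ => by positivity) (mem_univ s)
  have hupper : ∑ ω : Fin l → Fin H, ∑ s : Fin H → Bool,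
        Real.exp (r * ∑ i, w i * centredSign s (ω i)) ≤
      Real.exp H * ((H : ℝ) ^ l * Real.exp (4 * r ^ 2 * (ζ * (α * H)))) := by
    rw [sum_comm]
    have hone : ∀ s : Fin H → Bool, ∑ ω : Fin l → Fin H,
        Real.exp (r * ∑ i, w i * centredSign s (ω i)) ≤
          (H : ℝ) ^ l * Real.exp (4 * r ^ 2 * (ζ * (α * H))) := by
      intro s
      refine (sum_exp_weighted_sum_le _ (sum_centredSign hH s) (abs_centredSign_le hH s) w hr0.le
        fun i => ⟨(hw i).1, ?_⟩).trans (by gcongr)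
      have := mul_le_mul_of_nonneg_left (hw i).2 hr0.le
      linarith
    refine (sum_le_sum fun s _ => hone s).trans ?_
    rw [sum_const, nsmul_eq_mul]
    refine mul_le_mul_of_nonneg_right ?_ (by positivity)
    have htwo : (2 : ℝ) ≤ Real.exp 1 := by linarith [Real.add_one_le_exp 1]
    have hpow := pow_le_pow_left₀ (by norm_num) htwo H
    rw [← Real.exp_nat_mul, mul_one] at hpow
    simpa using hpow
  have hexponent : (H : ℝ) + 4 * r ^ 2 * (ζ * (α * H)) ≤ -1 * H + r * (α * H / 512) := by
    have hrα : 2 * 1024 ≤ r * α := by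
      rw [hr, one_div, inv_mul_eq_div, le_div_iff₀ (by positivity)]
      norm_num at hα hζ' ⊢
      linarith
    have : 4 * r ^ 2 * (ζ * (α * H)) = r * α * H / 1024 := by
      calc 4 * r ^ 2 * (ζ * (α * H)) = 4 * (r * ζ) * (r * α * H) := by ring
        _ = _ := by rw [hrζ]; ring
    nlinarith [mul_le_mul_of_nonneg_right hrα hH'.le]
  have hkey : (B.card : ℝ) * Real.exp (r * (α * H / 512)) ≤
      ((H : ℝ) ^ l * Real.exp (-1 * H)) * Real.exp (r * (α * H / 512)) := by
    refine (hlower.trans hupper).trans ?_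
    rw [mul_left_comm, mul_assoc ((H : ℝ) ^ l), ← Real.exp_add, ← Real.exp_add]
    exact mul_le_mul_of_nonneg_left (Real.exp_le_exp.2 hexponent) (by positivity)
  exact le_of_mul_le_mul_right hkey (Real.exp_pos _)

/-- If more than `H / 32` values lie outside `[α * (15 / 16), 2 * α]`, the total deviation from
`α` is at least `α * H / 512`. -/
lemma sum_abs_sub_ge_of_card_lt {H : ℕ} {α : ℝ} (hα : 0 < α) (X : Fin H → ℝ)
    (h : ((univ.filter fun j => α * (15 / 16) ≤ X j ∧ X j ≤ 2 * α).card : ℝ) < 31 / 32 * H) :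
    α * H / 512 ≤ ∑ j, |X j - α| := by
  set p : Fin H → Prop := fun j => α * (15 / 16) ≤ X j ∧ X j ≤ 2 * α with hp
  have hcard : ((univ.filter p).card : ℝ) + ((univ.filter fun j => ¬ p j).card : ℝ) = H := by
    have := card_filter_add_card_filter_not (s := (univ : Finset (Fin H))) p
    rw [card_univ, Fintype.card_fin] at this
    exact_mod_cast this
  have hbad : ((univ.filter fun j => ¬ p j).card : ℝ) * (α / 16) ≤ ∑ j, |X j - α| := by
    rw [← nsmul_eq_mul, ← sum_const]
    refine (sum_le_sum fun j hj => ?_).trans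
      (sum_le_sum_of_subset_of_nonneg (subset_univ _) fun _ _ _ => abs_nonneg _)
    have hj' := (mem_filter.1 hj).2
    rw [hp, not_and_or, not_le, not_le] at hj'
    rcases hj' with hlow | hhigh
    · rw [abs_sub_comm]
      exact le_trans (by linarith) (le_abs_self _)
    · exact le_trans (by linarith) (le_abs_self _)
  nlinarith

end

/-- Weighted balls-into-bins (Lemma: at least `31/32` of the bins get total weight in
`[α·15/16, 2α]`, with probability `1 - exp(-Ω(H))`). The sample space is the set of
functions `ω : Fin l → Fin H` with the uniform measure, so the probability of an event
is its cardinality divided by `H ^ l`. -/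
theorem balls_into_bins_weighted :
    ∃ (ζ₀ C : ℝ) (H₀ : ℕ), 0 < ζ₀ ∧ 0 < C ∧
      ∀ (H l : ℕ), H₀ ≤ H → ∀ (α ζ : ℝ), (0.01 : ℝ) ≤ α → 0 < ζ → ζ ≤ ζ₀ →
        ∀ (w : Fin l → ℝ), (∀ i, 0 ≤ w i ∧ w i ≤ ζ) → (∑ i, w i) = α * H →
          1 - Real.exp (-C * H) ≤
            ((Finset.univ.filter (fun ω : Fin l → Fin H =>
                (31 / 32 : ℝ) * H ≤
                  ((Finset.univ.filter (fun j : Fin H =>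
                      α * (15 / 16) ≤ (∑ i ∈ Finset.univ.filter (fun i => ω i = j), w i) ∧
                      (∑ i ∈ Finset.univ.filter (fun i => ω i = j), w i) ≤ 2 * α)).card : ℝ))).card : ℝ)
              / (H : ℝ) ^ l := by
  refine ⟨1 / 10 ^ 9, 1, 1, by norm_num, one_pos, ?_⟩
  intro H l hH α ζ hα hζ hζ' w hw hsum
  have hα0 : 0 < α := lt_of_lt_of_le (by norm_num) hα
  have hH' : (0 : ℝ) < H := by exact_mod_cast hH
  have hpow : (0 : ℝ) < (H : ℝ) ^ l := by positivity
  rw [le_div_iff₀ hpow]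
  set p : (Fin l → Fin H) → Prop := fun ω => (31 / 32 : ℝ) * H ≤
    ((Finset.univ.filter (fun j : Fin H =>
      α * (15 / 16) ≤ (∑ i ∈ Finset.univ.filter (fun i => ω i = j), w i) ∧
      (∑ i ∈ Finset.univ.filter (fun i => ω i = j), w i) ≤ 2 * α)).card : ℝ)
  have hcard : ((Finset.univ.filter p).card : ℝ) +
      ((Finset.univ.filter fun ω => ¬ p ω).card : ℝ) = (H : ℝ) ^ l := by
    have := Finset.card_filter_add_card_filter_not
      (s := (Finset.univ : Finset (Fin l → Fin H))) p
    rw [Finset.card_univ, Fintype.card_fun, Fintype.card_fin, Fintype.card_fin] at this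
    exact_mod_cast this
  have hbad : ((Finset.univ.filter fun ω => ¬ p ω).card : ℝ) ≤
      (H : ℝ) ^ l * Real.exp (-1 * H) := by
    refine le_trans ?_ (card_large_deviation_le hH hα hζ hζ' w hw hsum)
    exact_mod_cast Finset.card_le_card (Finset.monotone_filter_right _ fun ω _ hω =>
      sum_abs_sub_ge_of_card_lt hα0 _ (not_le.1 hω))
  linarith
end

section
/- There exist constants Δ₀ > 2, C > 0, and H₀ ∈ ℕ with the following property. Let H ≥ H₀ and l be natural numbers and Δ ≥ Δ₀ a real with l > H·Δ. When the l balls are thrown independently and uniformly at random into the H bins, then with probability at least 1 − exp(−C·H), the number of bins that contain at least 2 balls is at least (31/32)·H. -/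
open scoped Classical

/-- Chernoff-type bound: few functions `ω : Fin l → Fin H` hit the set `S` at most `m` times. -/
theorem card_filter_hits_le (H l m : ℕ) (S : Finset (Fin H)) :
    ((Finset.univ.filter (fun ω : Fin l → Fin H =>
      (Finset.univ.filter (fun i => ω i ∈ S)).card ≤ m)).card : ℝ) ≤
      2 ^ m * ((H : ℝ) - S.card / 2) ^ l := by
  have hsum : ∑ j : Fin H, (if j ∈ S then (1 / 2 : ℝ) else 1) = (H : ℝ) - S.card / 2 := by
    have h (j : Fin H) :
        (if j ∈ S then (1 / 2 : ℝ) else 1) = 1 - if j ∈ S then (1 / 2 : ℝ) else 0 := by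
      split_ifs <;> norm_num
    simp only [h, Finset.sum_sub_distrib, Finset.sum_ite_mem, Finset.univ_inter,
      Finset.sum_const, Finset.card_univ, Fintype.card_fin, nsmul_eq_mul]
    ring
  rw [← hsum, Fintype.sum_pow, Finset.mul_sum, Finset.card_eq_sum_ones, Nat.cast_sum,
    Finset.sum_filter]
  refine Finset.sum_le_sum fun ω _ => ?_
  have hprod : ∏ i, (if ω i ∈ S then (1 / 2 : ℝ) else 1) =
      (1 / 2) ^ (Finset.univ.filter (fun i => ω i ∈ S)).card := by
    rw [← Finset.prod_filter, Finset.prod_const]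
  rw [hprod]
  split_ifs with h
  · calc ((1 : ℕ) : ℝ) = 2 ^ m * (1 / 2) ^ m := by rw [← mul_pow]; norm_num
      _ ≤ _ := by
        gcongr ?_ * ?_
        exact pow_le_pow_of_le_one (by norm_num) (by norm_num) h
  · positivity

/-- If every bin of `S` holds at most one ball, then `S` holds at most `S.card` balls. -/
theorem card_hits_le_card {H l : ℕ} (ω : Fin l → Fin H) (S : Finset (Fin H))
    (hS : ∀ j ∈ S, (Finset.univ.filter (fun i => ω i = j)).card ≤ 1) :
    (Finset.univ.filter (fun i => ω i ∈ S)).card ≤ S.card := by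
  refine (Finset.card_le_mul_card_image_of_maps_to (f := ω) (t := S) (by simp) 1
    fun j hj => (Finset.card_le_card ?_).trans (hS j hj)).trans_eq (one_mul _)
  intro i
  simp

/-- The outcomes with too few bins holding two balls are exponentially rare. -/
theorem card_filter_few_heavy_le (H l : ℕ) (hH : 0 < H) (hl : (H : ℝ) * 192 ≤ l) :
    ((Finset.univ.filter (fun ω : Fin l → Fin H =>
      ¬ (31 / 32 : ℝ) * H ≤
        ((Finset.univ.filter (fun j : Fin H =>
          2 ≤ (Finset.univ.filter (fun i => ω i = j)).card)).card : ℝ))).card : ℝ) ≤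
      Real.exp (-1 * H) * (H : ℝ) ^ l := by
  set large : Finset (Finset (Fin H)) :=
    Finset.univ.filter (fun S => (H : ℝ) / 32 ≤ S.card) with hlarge
  have hH' : (0 : ℝ) < H := by exact_mod_cast hH
  have hsub : (Finset.univ.filter (fun ω : Fin l → Fin H =>
      ¬ (31 / 32 : ℝ) * H ≤
        ((Finset.univ.filter (fun j : Fin H =>
          2 ≤ (Finset.univ.filter (fun i => ω i = j)).card)).card : ℝ))) ⊆
      large.biUnion (fun S => Finset.univ.filter (fun ω : Fin l → Fin H =>
        (Finset.univ.filter (fun i => ω i ∈ S)).card ≤ H)) := by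
    intro ω hω
    rw [Finset.mem_filter] at hω
    have hω := hω.2
    set S := Finset.univ.filter (fun j : Fin H =>
      ¬ 2 ≤ (Finset.univ.filter (fun i => ω i = j)).card) with hS
    have hcard : ((Finset.univ.filter (fun j : Fin H =>
        2 ≤ (Finset.univ.filter (fun i => ω i = j)).card)).card : ℝ) + S.card = H := by
      have := Finset.card_filter_add_card_filter_not (s := (Finset.univ : Finset (Fin H)))
        (fun j : Fin H => 2 ≤ (Finset.univ.filter (fun i => ω i = j)).card)
      rw [Finset.card_univ, Fintype.card_fin] at this
      exact_mod_cast this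
    simp only [Finset.mem_biUnion, Finset.mem_filter, Finset.mem_univ, true_and, hlarge]
    refine ⟨S, by linarith, (card_hits_le_card ω S fun j hj => ?_).trans ?_⟩
    · have := (Finset.mem_filter.1 hj).2
      omega
    · simpa using Finset.card_le_univ S
  have htwo : (2 : ℝ) ^ H ≤ Real.exp H := by
    rw [← mul_one (H : ℝ), Real.exp_nat_mul]
    gcongr
    linarith [Real.add_one_le_exp (1 : ℝ)]
  have hterm : ∀ S ∈ large, ((Finset.univ.filter (fun ω : Fin l → Fin H =>
      (Finset.univ.filter (fun i => ω i ∈ S)).card ≤ H)).card : ℝ) ≤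
      Real.exp (-2 * H) * (H : ℝ) ^ l := by
    intro S hS
    have hS : (H : ℝ) / 32 ≤ S.card := (Finset.mem_filter.1 hS).2
    have hSH : (S.card : ℝ) ≤ H := by
      exact_mod_cast (Finset.card_le_univ S).trans_eq (Fintype.card_fin H)
    have hbase : (H : ℝ) - S.card / 2 ≤ Real.exp (-1 / 64) * H := by
      nlinarith [Real.add_one_le_exp (-1 / 64 : ℝ)]
    calc _ ≤ (2 : ℝ) ^ H * ((H : ℝ) - S.card / 2) ^ l := card_filter_hits_le H l H S
      _ ≤ Real.exp H * (Real.exp (-1 / 64) * H) ^ l := by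
        have : (0 : ℝ) ≤ (H : ℝ) - S.card / 2 := by linarith
        gcongr
      _ = Real.exp (H + l * (-1 / 64)) * (H : ℝ) ^ l := by
        rw [mul_pow, ← Real.exp_nat_mul, Real.exp_add, mul_assoc]
      _ ≤ _ := by
        gcongr
        linarith
  have hlcard : (large.card : ℝ) ≤ Real.exp H := by
    refine le_trans ?_ htwo
    have := Finset.card_le_univ large
    rw [Fintype.card_finset, Fintype.card_fin] at this
    exact_mod_cast this
  calc _ ≤ ∑ S ∈ large, ((Finset.univ.filter (fun ω : Fin l → Fin H =>
        (Finset.univ.filter (fun i => ω i ∈ S)).card ≤ H)).card : ℝ) := by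
        exact_mod_cast (Finset.card_le_card hsub).trans Finset.card_biUnion_le
    _ ≤ large.card * (Real.exp (-2 * H) * (H : ℝ) ^ l) := by
        rw [← nsmul_eq_mul]
        exact Finset.sum_le_card_nsmul _ _ _ hterm
    _ ≤ Real.exp H * (Real.exp (-2 * H) * (H : ℝ) ^ l) := by gcongr
    _ = _ := by
        rw [← mul_assoc, ← Real.exp_add]
        ring_nf

/-- Balls-into-bins (Lemma: with `l > H·Δ` balls for large enough `Δ`, at least `31/32`
of the bins contain at least two balls, with probability `1 - exp(-Ω(H))`). The sample
space is the set of functions `ω : Fin l → Fin H` with the uniform measure, so the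
probability of an event is its cardinality divided by `H ^ l`. -/
theorem balls_into_bins_two_balls :
    ∃ (Δ₀ C : ℝ) (H₀ : ℕ), 2 < Δ₀ ∧ 0 < C ∧
      ∀ (H l : ℕ), H₀ ≤ H → ∀ (Δ : ℝ), Δ₀ ≤ Δ → (H : ℝ) * Δ < l →
        1 - Real.exp (-C * H) ≤
          ((Finset.univ.filter (fun ω : Fin l → Fin H =>
              (31 / 32 : ℝ) * H ≤
                ((Finset.univ.filter (fun j : Fin H =>
                    2 ≤ (Finset.univ.filter (fun i => ω i = j)).card)).card : ℝ))).card : ℝ)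
            / (H : ℝ) ^ l := by
  refine ⟨192, 1, 1, by norm_num, one_pos, fun H l hH Δ hΔ hl => ?_⟩
  have hH' : (0 : ℝ) < H := by exact_mod_cast hH
  have hbad := card_filter_few_heavy_le H l hH (by nlinarith)
  have htotal := Finset.card_filter_add_card_filter_not
    (s := (Finset.univ : Finset (Fin l → Fin H))) (fun ω => (31 / 32 : ℝ) * H ≤
      ((Finset.univ.filter (fun j : Fin H =>
        2 ≤ (Finset.univ.filter (fun i => ω i = j)).card)).card : ℝ))
  rw [Finset.card_univ, Fintype.card_fun, Fintype.card_fin, Fintype.card_fin,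
    ← Nat.cast_inj (R := ℝ), Nat.cast_add, Nat.cast_pow] at htotal
  rw [le_div_iff₀ (by positivity)]
  linarith
end

section
/- There exist constants ζ₀ > 0, Δ₀ > 2, C > 0, and H₀ ∈ ℕ with the following property. Let H ≥ H₀ and l be natural numbers, let Δ ≥ Δ₀ be a real with l > H·Δ, let α ≥ 0.01 and 0 < ζ ≤ ζ₀ be reals, and let w_1, …, w_l be real weights with 0 ≤ w_i ≤ ζ for all i and ∑_{i=1}^l w_i = α·H. When the l balls are thrown independently and uniformly at random into the H bins, then with probability at least 1 − exp(−C·H), the number of bins j that contain at least 2 balls and whose weight lies in the interval [α·(15/16), 2α] is at least (15/16)·H. -/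
open scoped Classical

/-- The total weight of the balls that land in the set `S` of bins. -/
noncomputable def weightIn {l H : ℕ} (w : Fin l → ℝ) (S : Finset (Fin H)) (ω : Fin l → Fin H) : ℝ :=
  ∑ i, if ω i ∈ S then w i else 0

theorem sum_binWeight_eq_weightIn {l H : ℕ} (w : Fin l → ℝ) (S : Finset (Fin H))
    (ω : Fin l → Fin H) :
    ∑ j ∈ S, ∑ i ∈ Finset.univ.filter (fun i => ω i = j), w i = weightIn w S ω := by
  simp only [Finset.sum_filter, weightIn]
  rw [Finset.sum_comm]
  simp

theorem sum_exp_weightIn_le {l H : ℕ} (hH : 0 < H) (w : Fin l → ℝ) (S : Finset (Fin H)) (t : ℝ) :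
    ∑ ω, Real.exp (t * weightIn w S ω) ≤
      (H : ℝ) ^ l * Real.exp ((S.card : ℝ) / H * ∑ i, (Real.exp (t * w i) - 1)) := by
  have hH' : (0 : ℝ) < H := by exact_mod_cast hH
  have hprod : ∑ ω : Fin l → Fin H, Real.exp (t * weightIn w S ω) =
      ∏ i, ∑ j : Fin H, Real.exp (t * if j ∈ S then w i else 0) := by
    rw [Finset.prod_univ_sum, Fintype.piFinset_univ]
    simp only [weightIn, Finset.mul_sum, Real.exp_sum]
  have hfactor : ∀ i, ∑ j : Fin H, Real.exp (t * if j ∈ S then w i else 0) =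
      H * (1 + (S.card : ℝ) / H * (Real.exp (t * w i) - 1)) := by
    intro i
    have hsplit : ∀ j : Fin H, Real.exp (t * if j ∈ S then w i else 0) =
        1 + if j ∈ S then Real.exp (t * w i) - 1 else 0 := by
      intro j
      split_ifs <;> simp
    simp only [hsplit, Finset.sum_add_distrib, Finset.sum_ite_mem, Finset.univ_inter,
      Finset.sum_const, nsmul_eq_mul, Finset.card_univ, Fintype.card_fin]
    field_simp
  have hnonneg : ∀ i, 0 ≤ ∑ j : Fin H, Real.exp (t * if j ∈ S then w i else 0) :=
    fun i => Finset.sum_nonneg fun j _ => (Real.exp_pos _).le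
  calc ∑ ω, Real.exp (t * weightIn w S ω)
      ≤ ∏ i : Fin l, ((H : ℝ) * Real.exp ((S.card : ℝ) / H * (Real.exp (t * w i) - 1))) := by
        rw [hprod]
        refine Finset.prod_le_prod (fun i _ => hnonneg i) fun i _ => ?_
        rw [hfactor i, add_comm]
        exact mul_le_mul_of_nonneg_left (Real.add_one_le_exp _) hH'.le
    _ = _ := by
        rw [Finset.prod_mul_distrib, ← Real.exp_sum, ← Finset.mul_sum]
        simp

/-- A two-sided Chernoff bound: `σ = 1` gives the upper tail and `σ = -1` the lower tail of
`weightIn w S`, whose mean is `|S| / H * ∑ i, w i`. -/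
theorem card_weightIn_deviation_le {l H : ℕ} (hH : 0 < H) {ζ σ : ℝ} (hζ : 0 < ζ)
    (hσ : σ = 1 ∨ σ = -1) (w : Fin l → ℝ) (hw : ∀ i, 0 ≤ w i ∧ w i ≤ ζ) (S : Finset (Fin H)) :
    ((Finset.univ.filter (fun ω : Fin l → Fin H =>
      (S.card : ℝ) / H * (∑ i, w i) / 16 ≤
        σ * (weightIn w S ω - (S.card : ℝ) / H * ∑ i, w i))).card : ℝ) ≤
      (H : ℝ) ^ l * Real.exp (-((S.card : ℝ) / H * (∑ i, w i) / (1024 * ζ))) := by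
  set m : ℝ := (S.card : ℝ) / H * ∑ i, w i with hm
  set t : ℝ := σ / (32 * ζ) with ht
  have hσ2 : σ ^ 2 = 1 := by rcases hσ with h | h <;> rw [h] <;> norm_num
  have hexp : ∀ i, Real.exp (t * w i) - 1 ≤ (t + 1 / (1024 * ζ)) * w i := by
    intro i
    obtain ⟨h0, h1⟩ := hw i
    have hr0 : 0 ≤ w i / ζ := by positivity
    have hr1 : w i / ζ ≤ 1 := (div_le_one hζ).2 h1
    have htw : t * w i = σ / 32 * (w i / ζ) := by rw [ht]; field_simp
    have habs : |t * w i| ≤ 1 := by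
      rw [htw, abs_le]
      rcases hσ with h | h <;> rw [h] <;> constructor <;> linarith
    have hquad := (abs_le.1 (Real.abs_exp_sub_one_sub_id_le habs)).2
    have hsq : (t * w i) ^ 2 ≤ 1 / (1024 * ζ) * w i := by
      have h2 : (t * w i) ^ 2 = (w i / ζ) ^ 2 / 1024 := by
        rw [htw, mul_pow, div_pow, hσ2]; ring
      have h3 : 1 / (1024 * ζ) * w i = (w i / ζ) / 1024 := by field_simp
      rw [h2, h3]
      nlinarith
    linarith
  have hsum : (S.card : ℝ) / H * ∑ i, (Real.exp (t * w i) - 1) ≤ (t + 1 / (1024 * ζ)) * m := by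
    calc (S.card : ℝ) / H * ∑ i, (Real.exp (t * w i) - 1)
        ≤ (S.card : ℝ) / H * ∑ i, (t + 1 / (1024 * ζ)) * w i := by
          gcongr with i; exact hexp i
      _ = _ := by rw [← Finset.mul_sum, hm]; ring
  have hmarkov : ((Finset.univ.filter (fun ω : Fin l → Fin H =>
      m / 16 ≤ σ * (weightIn w S ω - m))).card : ℝ) * Real.exp (t * m + m / (512 * ζ)) ≤
      ∑ ω, Real.exp (t * weightIn w S ω) := by
    rw [← nsmul_eq_mul]
    refine (Finset.card_nsmul_le_sum _ (fun ω => Real.exp (t * weightIn w S ω)) _ ?_).trans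
      (Finset.sum_le_univ_sum_of_nonneg fun ω => (Real.exp_pos _).le)
    intro ω hω
    have hω' := (Finset.mem_filter.1 hω).2
    refine Real.exp_le_exp.2 ?_
    have h1 : t * weightIn w S ω = t * m + σ * (weightIn w S ω - m) / (32 * ζ) := by
      rw [ht]; ring
    have h2 : m / (512 * ζ) = m / 16 / (32 * ζ) := by
      ring
    rw [h1, h2]
    gcongr
  have hbound := hmarkov.trans (sum_exp_weightIn_le hH w S t)
  rw [← le_div_iff₀ (Real.exp_pos _), mul_div_assoc ((H : ℝ) ^ l),
    ← Real.exp_sub] at hbound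
  refine hbound.trans ?_
  gcongr
  have h3 : (t + 1 / (1024 * ζ)) * m - (t * m + m / (512 * ζ)) = -(m / (1024 * ζ)) := by
    field_simp; ring
  linarith

/-- A union bound over all sets `S` of at least `H / 48` bins. -/
theorem card_exists_deviation_le {l H : ℕ} (hH : 0 < H) {ζ σ : ℝ} (hζ : 0 < ζ)
    (hσ : σ = 1 ∨ σ = -1) (w : Fin l → ℝ) (hw : ∀ i, 0 ≤ w i ∧ w i ≤ ζ)
    (hmean : 48 * 1024 * 4 * ζ * H ≤ ∑ i, w i) :
    ((Finset.univ.filter (fun ω : Fin l → Fin H => ∃ S : Finset (Fin H), (H : ℝ) ≤ 48 * S.card ∧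
      (S.card : ℝ) / H * (∑ i, w i) / 16 ≤
        σ * (weightIn w S ω - (S.card : ℝ) / H * ∑ i, w i))).card : ℝ) ≤
      (H : ℝ) ^ l * Real.exp (-3 * H) := by
  have hH' : (0 : ℝ) < H := by exact_mod_cast hH
  set E : Finset (Fin H) → Finset (Fin l → Fin H) := fun S => Finset.univ.filter fun ω =>
    (S.card : ℝ) / H * (∑ i, w i) / 16 ≤ σ * (weightIn w S ω - (S.card : ℝ) / H * ∑ i, w i)
    with hE
  have hsub : (Finset.univ.filter (fun ω : Fin l → Fin H => ∃ S : Finset (Fin H),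
      (H : ℝ) ≤ 48 * S.card ∧ (S.card : ℝ) / H * (∑ i, w i) / 16 ≤
        σ * (weightIn w S ω - (S.card : ℝ) / H * ∑ i, w i))) ⊆
      (Finset.univ.filter fun S : Finset (Fin H) => (H : ℝ) ≤ 48 * S.card).biUnion E := by
    intro ω hω
    obtain ⟨S, hS, hdev⟩ := (Finset.mem_filter.1 hω).2
    simp only [Finset.mem_biUnion, hE, Finset.mem_filter, Finset.mem_univ, true_and]
    exact ⟨S, hS, hdev⟩
  have hone : ∀ S ∈ Finset.univ.filter (fun S : Finset (Fin H) => (H : ℝ) ≤ 48 * S.card),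
      ((E S).card : ℝ) ≤ (H : ℝ) ^ l * Real.exp (-4 * H) := by
    intro S hS
    have hS' := (Finset.mem_filter.1 hS).2
    refine (card_weightIn_deviation_le hH hζ hσ w hw S).trans ?_
    gcongr
    rw [neg_mul, neg_le_neg_iff, le_div_iff₀ (by positivity)]
    have hfrac : (1 : ℝ) / 48 ≤ S.card / H := by
      rw [le_div_iff₀ hH']; linarith
    calc 4 * (H : ℝ) * (1024 * ζ) = 1 / 48 * (48 * 1024 * 4 * ζ * H) := by ring
      _ ≤ _ := by gcongr
  have hnum : ((Finset.univ.filter fun S : Finset (Fin H) => (H : ℝ) ≤ 48 * S.card).card : ℝ) ≤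
      Real.exp H := by
    calc ((Finset.univ.filter fun S : Finset (Fin H) => (H : ℝ) ≤ 48 * S.card).card : ℝ)
        ≤ ((Finset.univ : Finset (Finset (Fin H))).card : ℝ) := by
          exact_mod_cast Finset.card_filter_le _ _
      _ = 2 ^ H := by simp
      _ ≤ Real.exp 1 ^ H := by
          gcongr
          linarith [Real.add_one_le_exp (1 : ℝ)]
      _ = Real.exp H := by rw [← Real.exp_nat_mul, mul_one]
  calc _ ≤ (((Finset.univ.filter fun S : Finset (Fin H) =>
          (H : ℝ) ≤ 48 * S.card).biUnion E).card : ℝ) := by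
        exact_mod_cast Finset.card_le_card hsub
    _ ≤ ∑ S ∈ Finset.univ.filter (fun S : Finset (Fin H) => (H : ℝ) ≤ 48 * S.card),
          ((E S).card : ℝ) := by exact_mod_cast Finset.card_biUnion_le
    _ ≤ Real.exp H * ((H : ℝ) ^ l * Real.exp (-4 * H)) := by
        refine (Finset.sum_le_card_nsmul _ _ _ hone).trans ?_
        rw [nsmul_eq_mul]
        gcongr
    _ = (H : ℝ) ^ l * (Real.exp H * Real.exp (-4 * H)) := by ring
    _ = _ := by rw [← Real.exp_add]; congr 2; ring

/-- Weighted balls-into-bins corollary: with `l > H·Δ` balls of weights in `[0, ζ]`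
summing to `α·H`, at least `15/16` of the bins contain at least two balls and have total
weight in `[α·15/16, 2α]`, with probability `1 - exp(-Ω(H))`. The sample space is the
set of functions `ω : Fin l → Fin H` with the uniform measure, so the probability of an
event is its cardinality divided by `H ^ l`. -/
theorem balls_into_bins_combined :
    ∃ (ζ₀ Δ₀ C : ℝ) (H₀ : ℕ), 0 < ζ₀ ∧ 2 < Δ₀ ∧ 0 < C ∧
      ∀ (H l : ℕ), H₀ ≤ H → ∀ (Δ : ℝ), Δ₀ ≤ Δ → (H : ℝ) * Δ < l →
        ∀ (α ζ : ℝ), (0.01 : ℝ) ≤ α → 0 < ζ → ζ ≤ ζ₀ →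
          ∀ (w : Fin l → ℝ), (∀ i, 0 ≤ w i ∧ w i ≤ ζ) → (∑ i, w i) = α * H →
            1 - Real.exp (-C * H) ≤
              ((Finset.univ.filter (fun ω : Fin l → Fin H =>
                  (15 / 16 : ℝ) * H ≤
                    ((Finset.univ.filter (fun j : Fin H =>
                        2 ≤ (Finset.univ.filter (fun i => ω i = j)).card ∧
                        α * (15 / 16) ≤ (∑ i ∈ Finset.univ.filter (fun i => ω i = j), w i) ∧
                        (∑ i ∈ Finset.univ.filter (fun i => ω i = j), w i) ≤ 2 * α)).card : ℝ))).card : ℝ)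
              / (H : ℝ) ^ l := by
  refine ⟨0.01 / (48 * 1024 * 4), 48 * 1024 * 4, 1, 1, by norm_num, by norm_num, one_pos, ?_⟩
  intro H l hH Δ hΔ hl α ζ hα hζ hζ₀ w hw hsum
  have hH' : (0 : ℝ) < H := by exact_mod_cast hH
  have hH1 : (1 : ℝ) ≤ H := by exact_mod_cast hH
  have hα0 : 0 < α := lt_of_lt_of_le (by norm_num) hα
  have hmean : 48 * 1024 * 4 * ζ * H ≤ ∑ i, w i := by
    rw [hsum]
    gcongr
    rw [le_div_iff₀ (by norm_num)] at hζ₀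
    linarith
  have hmean_one : 48 * 1024 * 4 * (1 : ℝ) * H ≤ ∑ _i : Fin l, (1 : ℝ) := by
    simp only [Finset.sum_const, Finset.card_univ, Fintype.card_fin, nsmul_eq_mul, mul_one]
    nlinarith
  have hlow := card_exists_deviation_le hH hζ (Or.inr rfl) w hw hmean
  have hhigh := card_exists_deviation_le hH hζ (Or.inl rfl) w hw hmean
  have hfew := card_exists_deviation_le (l := l) hH one_pos (Or.inr rfl) (fun _ => 1)
    (fun _ => ⟨zero_le_one, le_rfl⟩) hmean_one
  set good : (Fin l → Fin H) → Finset (Fin H) := fun ω => Finset.univ.filter (fun j : Fin H =>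
    2 ≤ (Finset.univ.filter (fun i => ω i = j)).card ∧
    α * (15 / 16) ≤ (∑ i ∈ Finset.univ.filter (fun i => ω i = j), w i) ∧
    (∑ i ∈ Finset.univ.filter (fun i => ω i = j), w i) ≤ 2 * α) with hgood
  set low := Finset.univ.filter (fun ω : Fin l → Fin H => ∃ S : Finset (Fin H),
    (H : ℝ) ≤ 48 * S.card ∧ (S.card : ℝ) / H * (∑ i, w i) / 16 ≤
      -1 * (weightIn w S ω - (S.card : ℝ) / H * ∑ i, w i)) with hlow_def
  set high := Finset.univ.filter (fun ω : Fin l → Fin H => ∃ S : Finset (Fin H),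
    (H : ℝ) ≤ 48 * S.card ∧ (S.card : ℝ) / H * (∑ i, w i) / 16 ≤
      1 * (weightIn w S ω - (S.card : ℝ) / H * ∑ i, w i)) with hhigh_def
  set few := Finset.univ.filter (fun ω : Fin l → Fin H => ∃ S : Finset (Fin H),
    (H : ℝ) ≤ 48 * S.card ∧ (S.card : ℝ) / H * (∑ _i : Fin l, (1 : ℝ)) / 16 ≤
      -1 * (weightIn (fun _ => 1) S ω - (S.card : ℝ) / H * ∑ _i : Fin l, (1 : ℝ))) with hfew_def
  have hbad : Finset.univ.filter (fun ω : Fin l → Fin H =>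
      ¬ (15 / 16 : ℝ) * H ≤ ((good ω).card : ℝ)) ⊆ low ∪ high ∪ few := by
    intro ω hω
    have hcard := (Finset.mem_filter.1 hω).2
    by_contra hnot
    simp only [Finset.mem_union, not_or, hlow_def, hhigh_def, hfew_def, Finset.mem_filter,
      Finset.mem_univ, true_and, not_exists, not_and, not_le] at hnot
    obtain ⟨⟨hnlow, hnhigh⟩, hnfew⟩ := hnot
    set L : Finset (Fin H) := Finset.univ.filter fun j =>
      (∑ i ∈ Finset.univ.filter (fun i => ω i = j), w i) < α * (15 / 16) with hL
    set U : Finset (Fin H) := Finset.univ.filter fun j =>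
      2 * α < ∑ i ∈ Finset.univ.filter (fun i => ω i = j), w i with hU
    set F : Finset (Fin H) := Finset.univ.filter fun j =>
      (Finset.univ.filter (fun i => ω i = j)).card ≤ 1 with hF
    have hcover : (Finset.univ : Finset (Fin H)) ⊆ good ω ∪ (L ∪ U ∪ F) := by
      intro j _
      simp only [hgood, hL, hU, hF, Finset.mem_union, Finset.mem_filter, Finset.mem_univ, true_and]
      by_contra hj
      simp only [not_or, not_lt, not_le] at hj
      exact hj.1 ⟨hj.2.2, hj.2.1.1, hj.2.1.2⟩
    have htotal : (H : ℝ) ≤ (good ω).card + (L.card + U.card + F.card) := by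
      have h1 := Finset.card_le_card hcover
      have h2 := Finset.card_union_le (good ω) (L ∪ U ∪ F)
      have h3 := Finset.card_union_le (L ∪ U) F
      have h4 := Finset.card_union_le L U
      rw [Finset.card_univ, Fintype.card_fin] at h1
      exact_mod_cast (by omega : H ≤ (good ω).card + (L.card + U.card + F.card))
    have hscale : ∀ S : Finset (Fin H), (S.card : ℝ) / H * ∑ i, w i = S.card * α := by
      intro S
      rw [hsum]; field_simp
    have hLsmall : 48 * (L.card : ℝ) < H := by
      by_contra hcon
      have hdev := hnlow L (not_lt.1 hcon)
      have hle : weightIn w L ω ≤ L.card * (α * (15 / 16)) := by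
        rw [← sum_binWeight_eq_weightIn, ← nsmul_eq_mul]
        exact Finset.sum_le_card_nsmul _ _ _ fun j hj => (Finset.mem_filter.1 hj).2.le
      rw [hscale] at hdev
      linarith
    have hUsmall : 48 * (U.card : ℝ) < H := by
      by_contra hcon
      have hdev := hnhigh U (not_lt.1 hcon)
      have hle : U.card * (2 * α) ≤ weightIn w U ω := by
        rw [← sum_binWeight_eq_weightIn, ← nsmul_eq_mul]
        exact Finset.card_nsmul_le_sum _ _ _ fun j hj => (Finset.mem_filter.1 hj).2.le
      rw [hscale] at hdev
      have hpos : 0 ≤ (U.card : ℝ) * α := by positivity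
      linarith
    have hFsmall : 48 * (F.card : ℝ) < H := by
      by_contra hcon
      have hdev := hnfew F (not_lt.1 hcon)
      have hle : weightIn (fun _ => 1) F ω ≤ F.card * 1 := by
        rw [← sum_binWeight_eq_weightIn, ← nsmul_eq_mul]
        refine Finset.sum_le_card_nsmul _ _ _ fun j hj => ?_
        rw [Finset.sum_const, nsmul_eq_mul, mul_one]
        exact_mod_cast (Finset.mem_filter.1 hj).2
      have hmany : (F.card : ℝ) * 2 ≤ F.card / H * ∑ _i : Fin l, (1 : ℝ) := by
        rw [div_mul_eq_mul_div, le_div_iff₀ hH', mul_assoc]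
        gcongr
        linarith
      have hpos : 0 ≤ (F.card : ℝ) := by positivity
      linarith
    linarith [not_le.1 hcard]
  have hbad_card : ((Finset.univ.filter (fun ω : Fin l → Fin H =>
      ¬ (15 / 16 : ℝ) * H ≤ ((good ω).card : ℝ))).card : ℝ) ≤
      (H : ℝ) ^ l * Real.exp (-1 * H) := by
    have h1 : ((Finset.univ.filter (fun ω : Fin l → Fin H =>
        ¬ (15 / 16 : ℝ) * H ≤ ((good ω).card : ℝ))).card : ℝ) ≤
        low.card + high.card + few.card := by
      have h2 := Finset.card_union_le (low ∪ high) few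
      have h3 := Finset.card_union_le low high
      exact_mod_cast (Finset.card_le_card hbad).trans (by omega)
    have hthree : 3 * Real.exp (-3 * H) ≤ Real.exp (-1 * H) := by
      have h4 : Real.exp (-1 * (H : ℝ)) = Real.exp (2 * H) * Real.exp (-3 * H) := by
        rw [← Real.exp_add]; congr 1; ring
      rw [h4]
      gcongr
      linarith [Real.add_one_le_exp (2 * (H : ℝ))]
    have hpow : (0 : ℝ) ≤ (H : ℝ) ^ l := by positivity
    nlinarith [mul_le_mul_of_nonneg_left hthree hpow]
  have hsplit : ((Finset.univ.filter (fun ω : Fin l → Fin H =>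
      (15 / 16 : ℝ) * H ≤ ((good ω).card : ℝ))).card : ℝ) +
      ((Finset.univ.filter (fun ω : Fin l → Fin H =>
      ¬ (15 / 16 : ℝ) * H ≤ ((good ω).card : ℝ))).card : ℝ) = (H : ℝ) ^ l := by
    have h := Finset.card_filter_add_card_filter_not (s := (Finset.univ : Finset (Fin l → Fin H)))
      (fun ω => (15 / 16 : ℝ) * H ≤ ((good ω).card : ℝ))
    rw [Finset.card_univ, Fintype.card_fun, Fintype.card_fin, Fintype.card_fin] at h
    exact_mod_cast h
  rw [le_div_iff₀ (by positivity)]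
  linarith
end

section
/- Let S be a finite index set and let (p_i)_{i∈S} be reals with 0 ≤ p_i ≤ 1/2 for every i ∈ S. Then ∑_{i∈S} p_i · ∏_{j∈S, j≠i} (1 − p_j) ≥ (∑_{i∈S} p_i) · 4^{−∑_{i∈S} p_i}. -/
/-- Bernoulli's inequality for the exponent `2 * x ∈ [0, 1]` at base `1 / 2`. -/
lemma four_rpow_neg_le_one_sub {x : ℝ} (h0 : 0 ≤ x) (h1 : x ≤ 1 / 2) :
    (4 : ℝ) ^ (-x) ≤ 1 - x := by
  have h := rpow_one_add_le_one_add_mul_self (s := -(1 / 2)) (p := 2 * x)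
    (by norm_num) (by linarith) (by linarith)
  have hbase : (1 + -(1 / 2) : ℝ) ^ (2 * x) = (4 : ℝ) ^ (-x) := by
    rw [Real.rpow_mul (by norm_num), Real.rpow_neg (by norm_num),
      ← Real.inv_rpow (by norm_num)]
    norm_num
  rw [hbase] at h
  linarith

lemma four_rpow_neg_sum_le_prod_one_sub {ι : Type*} (S : Finset ι) (p : ι → ℝ)
    (hp : ∀ i ∈ S, 0 ≤ p i ∧ p i ≤ 1 / 2) :
    (4 : ℝ) ^ (-(∑ i ∈ S, p i)) ≤ ∏ i ∈ S, (1 - p i) := by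
  rw [← Finset.sum_neg_distrib, Real.rpow_sum_of_pos (by norm_num)]
  exact Finset.prod_le_prod (fun i _ => by positivity)
    fun i hi => four_rpow_neg_le_one_sub (hp i hi).1 (hp i hi).2

/-- Lower bound on the probability of exactly one transmission: for reals
`0 ≤ p i ≤ 1/2`,
`∑ p i · ∏_{j ≠ i} (1 - p j) ≥ (∑ p i) · 4 ^ (-∑ p i)`. -/
theorem exactly_one_lower_bound {ι : Type*} [DecidableEq ι] (S : Finset ι) (p : ι → ℝ)
    (hp : ∀ i ∈ S, 0 ≤ p i ∧ p i ≤ 1 / 2) :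
    (∑ i ∈ S, p i) * (4 : ℝ) ^ (-(∑ i ∈ S, p i)) ≤
      ∑ i ∈ S, p i * ∏ j ∈ S.erase i, (1 - p j) := by
  rw [Finset.sum_mul]
  refine Finset.sum_le_sum fun i hi => mul_le_mul_of_nonneg_left ?_ (hp i hi).1
  have hsum : ∑ j ∈ S.erase i, p j ≤ ∑ j ∈ S, p j :=
    Finset.sum_le_sum_of_subset_of_nonneg (Finset.erase_subset i S) fun j hj _ => (hp j hj).1
  calc (4 : ℝ) ^ (-(∑ j ∈ S, p j)) ≤ (4 : ℝ) ^ (-(∑ j ∈ S.erase i, p j)) :=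
        Real.rpow_le_rpow_of_exponent_le (by norm_num) (neg_le_neg hsum)
    _ ≤ ∏ j ∈ S.erase i, (1 - p j) :=
        four_rpow_neg_sum_le_prod_one_sub _ p fun j hj => hp j (Finset.mem_of_mem_erase hj)
end

section
/- Let S be a finite index set and let (p_i)_{i∈S} be reals with 0 ≤ p_i ≤ 1/2 for every i ∈ S. Then ∑_{i∈S} p_i · ∏_{j∈S, j≠i} (1 − p_j) ≤ 2 · (∑_{i∈S} p_i) · exp(−∑_{i∈S} p_i). -/
/-- Upper bound on the probability of exactly one transmission: for reals
`0 ≤ p i ≤ 1/2`,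
`∑ p i · ∏_{j ≠ i} (1 - p j) ≤ 2 · (∑ p i) · exp (-∑ p i)`. -/
theorem exactly_one_upper_bound {ι : Type*} [DecidableEq ι] (S : Finset ι) (p : ι → ℝ)
    (hp : ∀ i ∈ S, 0 ≤ p i ∧ p i ≤ 1 / 2) :
    ∑ i ∈ S, p i * ∏ j ∈ S.erase i, (1 - p j) ≤
      2 * (∑ i ∈ S, p i) * Real.exp (-(∑ i ∈ S, p i)) := by
  have nonneg_one_sub : ∀ j ∈ S, 0 ≤ 1 - p j := fun j hj => by linarith [(hp j hj).2]
  have prod_le : ∏ j ∈ S, (1 - p j) ≤ Real.exp (-(∑ i ∈ S, p i)) := by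
    rw [← Finset.sum_neg_distrib, Real.exp_sum]
    exact Finset.prod_le_prod nonneg_one_sub fun j _ => Real.one_sub_le_exp_neg (p j)
  have prod_erase_le : ∀ i ∈ S,
      ∏ j ∈ S.erase i, (1 - p j) ≤ 2 * Real.exp (-(∑ i ∈ S, p i)) := by
    intro i hi
    have erase_nonneg : 0 ≤ ∏ j ∈ S.erase i, (1 - p j) :=
      Finset.prod_nonneg fun j hj => nonneg_one_sub j (Finset.mem_of_mem_erase hj)
    rw [← Finset.mul_prod_erase S _ hi] at prod_le
    nlinarith [(hp i hi).2]
  calc ∑ i ∈ S, p i * ∏ j ∈ S.erase i, (1 - p j)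
      ≤ ∑ i ∈ S, p i * (2 * Real.exp (-(∑ i ∈ S, p i))) :=
        Finset.sum_le_sum fun i hi =>
          mul_le_mul_of_nonneg_left (prod_erase_le i hi) (hp i hi).1
    _ = 2 * (∑ i ∈ S, p i) * Real.exp (-(∑ i ∈ S, p i)) := by
        rw [← Finset.sum_mul]; ring
end

section
/- Let H ≥ 1 and l be natural numbers, let ζ > 0 and α > 0 be reals, and let w_1, …, w_l be real weights with 0 ≤ w_i ≤ ζ for all i and ∑_{i=1}^l w_i = α·H. When the l balls are thrown independently and uniformly at random into the H bins, then for every fixed bin j, Pr[the weight of bin j is at least 2α] ≤ exp(−α/(3ζ)). -/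
open scoped Classical

/-- The exponential moment of the weight of bin `j`, summed over all outcomes, factors over the
balls. -/
lemma sum_exp_bin_weight {l H : ℕ} (v : Fin l → ℝ) (j : Fin H) :
    ∑ ω : Fin l → Fin H, Real.exp (∑ i ∈ Finset.univ.filter (fun i => ω i = j), v i)
      = ∏ i, ((H : ℝ) + (Real.exp (v i) - 1)) := by
  have hball (i : Fin l) :
      (H : ℝ) + (Real.exp (v i) - 1) = ∑ k : Fin H, if k = j then Real.exp (v i) else 1 := by
    have hsplit (k : Fin H) : (if k = j then Real.exp (v i) else 1)
        = 1 + if k = j then Real.exp (v i) - 1 else 0 := by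
      split_ifs <;> ring
    simp [hsplit, Finset.sum_add_distrib]
  simp_rw [hball]
  rw [Finset.prod_univ_sum, Fintype.piFinset_univ]
  refine Finset.sum_congr rfl fun ω _ => ?_
  rw [Real.exp_sum, Finset.prod_filter]

/-- Bernoulli's inequality in exponential form. -/
lemma exp_log_two_mul_le {x : ℝ} (h0 : 0 ≤ x) (h1 : x ≤ 1) :
    Real.exp (Real.log 2 * x) ≤ 1 + x := by
  have h := rpow_one_add_le_one_add_mul_self (s := 1) (by norm_num) h0 h1
  rwa [one_add_one_eq_two, mul_one, Real.rpow_def_of_pos two_pos] at h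

/-- For normalized weights in `[0, 1]`, the exponential moment of the weight of bin `j` with
parameter `log 2` is at most the exponential of the mean weight. -/
lemma sum_exp_log_two_bin_weight_le {l H : ℕ} (hH : 1 ≤ H) (x : Fin l → ℝ)
    (hx : ∀ i, 0 ≤ x i ∧ x i ≤ 1) (j : Fin H) :
    ∑ ω : Fin l → Fin H,
        Real.exp (∑ i ∈ Finset.univ.filter (fun i => ω i = j), Real.log 2 * x i)
      ≤ (H : ℝ) ^ l * Real.exp ((∑ i, x i) / H) := by
  have hH0 : (0 : ℝ) < H := by exact_mod_cast hH
  have hH1 : (1 : ℝ) ≤ H := by exact_mod_cast hH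
  rw [sum_exp_bin_weight (fun i => Real.log 2 * x i)]
  calc ∏ i, ((H : ℝ) + (Real.exp (Real.log 2 * x i) - 1))
      ≤ ∏ i, ((H : ℝ) * Real.exp (x i / H)) := by
        refine Finset.prod_le_prod (fun i _ => ?_) (fun i _ => ?_)
        · linarith [Real.exp_pos (Real.log 2 * x i)]
        · have hexp := mul_le_mul_of_nonneg_left (Real.add_one_le_exp (x i / H)) hH0.le
          have hmul : (H : ℝ) * (x i / H + 1) = x i + H := by field_simp
          linarith [exp_log_two_mul_le (hx i).1 (hx i).2]
    _ = (H : ℝ) ^ l * Real.exp ((∑ i, x i) / H) := by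
        rw [Finset.prod_mul_distrib, ← Real.exp_sum, Finset.sum_div]
        simp

/-- Single-bin upper-tail bound for weighted balls-into-bins: with weights in `[0, ζ]`
summing to `α·H`, the probability that a fixed bin `j` receives total weight at least
`2α` is at most `exp (-α / (3ζ))`. The sample space is the set of functions
`ω : Fin l → Fin H` with the uniform measure, so the probability of an event is its
cardinality divided by `H ^ l`. -/
theorem bin_weight_upper_tail (H l : ℕ) (hH : 1 ≤ H) (ζ α : ℝ) (hζ : 0 < ζ) (hα : 0 < α)
    (w : Fin l → ℝ) (hw : ∀ i, 0 ≤ w i ∧ w i ≤ ζ) (hsum : (∑ i, w i) = α * H)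
    (j : Fin H) :
    ((Finset.univ.filter (fun ω : Fin l → Fin H =>
        2 * α ≤ ∑ i ∈ Finset.univ.filter (fun i => ω i = j), w i)).card : ℝ)
      / (H : ℝ) ^ l ≤ Real.exp (-α / (3 * ζ)) := by
  have hH0 : (0 : ℝ) < H := by exact_mod_cast hH
  have hmoment := sum_exp_log_two_bin_weight_le hH (fun i => w i / ζ)
    (fun i => ⟨div_nonneg (hw i).1 hζ.le, (div_le_one hζ).2 (hw i).2⟩) j
  have hmean : (∑ i, w i / ζ) / H = α / ζ := by
    rw [← Finset.sum_div, hsum]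
    field_simp
  rw [hmean] at hmoment
  set S := Finset.univ.filter (fun ω : Fin l → Fin H =>
    2 * α ≤ ∑ i ∈ Finset.univ.filter (fun i => ω i = j), w i)
  have hmarkov : (S.card : ℝ) * Real.exp (Real.log 2 * (2 * α / ζ))
      ≤ (H : ℝ) ^ l * Real.exp (α / ζ) := by
    refine le_trans ?_ hmoment
    rw [← nsmul_eq_mul]
    refine (Finset.card_nsmul_le_sum S _ _ fun ω hω => ?_).trans
      (Finset.sum_le_sum_of_subset_of_nonneg (Finset.subset_univ S)
        fun ω _ _ => (Real.exp_pos _).le)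
    rw [← Finset.mul_sum, ← Finset.sum_div]
    have hheavy := (Finset.mem_filter.1 hω).2
    have hlog := Real.log_nonneg one_le_two
    gcongr
  rw [div_le_iff₀ (pow_pos hH0 l)]
  refine le_of_mul_le_mul_right (hmarkov.trans ?_)
    (Real.exp_pos (Real.log 2 * (2 * α / ζ)))
  rw [mul_comm (Real.exp (-α / (3 * ζ))), mul_assoc, ← Real.exp_add]
  refine mul_le_mul_of_nonneg_left (Real.exp_le_exp.2 ?_) (pow_pos hH0 l).le
  have hratio : 0 < α / ζ := div_pos hα hζ
  have hthird : -α / (3 * ζ) = -(1 / 3) * (α / ζ) := by field_simp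
  have hdouble : 2 * α / ζ = 2 * (α / ζ) := by ring
  rw [hthird, hdouble]
  nlinarith [Real.log_two_gt_d9]
end

section
/- Let H ≥ 1 and l be natural numbers, let ζ > 0 and α > 0 be reals, and let w_1, …, w_l be real weights with 0 ≤ w_i ≤ ζ for all i and ∑_{i=1}^l w_i = α·H. When the l balls are thrown independently and uniformly at random into the H bins, then for every fixed bin j, Pr[the weight of bin j is at most (15/16)·α] ≤ exp(−α/(512·ζ)). -/
open scoped Classical

/-- Second-order upper bound for the exponential at nonpositive arguments. -/
theorem exp_neg_le_quadratic {x : ℝ} (hx : 0 ≤ x) : Real.exp (-x) ≤ 1 - x + x ^ 2 / 2 := by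
  have h := Real.quadratic_le_exp_of_nonneg hx
  have hq : 0 ≤ 1 - x + x ^ 2 / 2 := by nlinarith [sq_nonneg (x - 1)]
  rw [Real.exp_neg, inv_le_iff_one_le_mul₀ (Real.exp_pos x)]
  calc (1 : ℝ) ≤ (1 - x + x ^ 2 / 2) * (1 + x + x ^ 2 / 2) := by nlinarith [sq_nonneg (x ^ 2)]
    _ ≤ (1 - x + x ^ 2 / 2) * Real.exp x := mul_le_mul_of_nonneg_left h hq

/-- The exponential moment of the weight of a bin factorizes over the balls. -/
theorem sum_exp_neg_bin_weight {H l : ℕ} (t : ℝ) (w : Fin l → ℝ) (j : Fin H) :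
    ∑ ω : Fin l → Fin H, Real.exp (-(t * ∑ i ∈ Finset.univ.filter (fun i => ω i = j), w i))
      = ∏ i, ((H : ℝ) + (Real.exp (-(t * w i)) - 1)) := by
  have hball (i : Fin l) : (H : ℝ) + (Real.exp (-(t * w i)) - 1)
      = ∑ k : Fin H, Real.exp (if k = j then -(t * w i) else 0) := by
    have hk (k : Fin H) : Real.exp (if k = j then -(t * w i) else 0)
        = 1 + if k = j then Real.exp (-(t * w i)) - 1 else 0 := by
      split_ifs <;> simp
    simp [hk, Finset.sum_add_distrib]
  simp_rw [hball, Finset.prod_univ_sum, Fintype.piFinset_univ, ← Real.exp_sum,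
    ← Finset.sum_filter, Finset.sum_neg_distrib, Finset.mul_sum]

/-- Exponential moment bound for the weight of a bin. -/
theorem sum_exp_neg_bin_weight_le {H l : ℕ} (hH : 1 ≤ H) {ζ α t : ℝ} (ht : 0 ≤ t)
    (w : Fin l → ℝ) (hw : ∀ i, 0 ≤ w i ∧ w i ≤ ζ) (hsum : (∑ i, w i) = α * H) (j : Fin H) :
    ∑ ω : Fin l → Fin H, Real.exp (-(t * ∑ i ∈ Finset.univ.filter (fun i => ω i = j), w i))
      ≤ (H : ℝ) ^ l * Real.exp (α * (-t + t ^ 2 * ζ / 2)) := by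
  have hH1 : (1 : ℝ) ≤ H := by exact_mod_cast hH
  have hH0 : (0 : ℝ) < H := by linarith
  rw [sum_exp_neg_bin_weight]
  calc ∏ i, ((H : ℝ) + (Real.exp (-(t * w i)) - 1))
      ≤ ∏ i, ((H : ℝ) * Real.exp (w i * ((-t + t ^ 2 * ζ / 2) / H))) := by
        refine Finset.prod_le_prod (fun i _ => ?_) (fun i _ => ?_)
        · linarith [Real.exp_pos (-(t * w i))]
        · obtain ⟨hw0, hwζ⟩ := hw i
          have hexp := exp_neg_le_quadratic (mul_nonneg ht hw0)
          have hsq : (t * w i) ^ 2 ≤ t ^ 2 * ζ * w i := by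
            nlinarith [mul_le_mul_of_nonneg_left hwζ (mul_nonneg (sq_nonneg t) hw0)]
          have hlin := mul_le_mul_of_nonneg_left
            (Real.add_one_le_exp (w i * ((-t + t ^ 2 * ζ / 2) / H))) hH0.le
          have hcancel : (H : ℝ) * (w i * ((-t + t ^ 2 * ζ / 2) / H) + 1)
              = w i * (-t + t ^ 2 * ζ / 2) + H := by field_simp
          linarith
    _ = (H : ℝ) ^ l * Real.exp (α * (-t + t ^ 2 * ζ / 2)) := by
        rw [Finset.prod_mul_distrib, ← Real.exp_sum, ← Finset.sum_mul, hsum]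
        simp only [Finset.prod_const, Finset.card_univ, Fintype.card_fin]
        congr 2
        field_simp

/-- Single-bin lower-tail bound for weighted balls-into-bins: with weights in `[0, ζ]`
summing to `α·H`, the probability that a fixed bin `j` receives total weight at most
`(15/16)·α` is at most `exp (-α / (512·ζ))`. The sample space is the set of functions
`ω : Fin l → Fin H` with the uniform measure, so the probability of an event is its
cardinality divided by `H ^ l`. -/
theorem bin_weight_lower_tail (H l : ℕ) (hH : 1 ≤ H) (ζ α : ℝ) (hζ : 0 < ζ) (hα : 0 < α)
    (w : Fin l → ℝ) (hw : ∀ i, 0 ≤ w i ∧ w i ≤ ζ) (hsum : (∑ i, w i) = α * H)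
    (j : Fin H) :
    ((Finset.univ.filter (fun ω : Fin l → Fin H =>
        (∑ i ∈ Finset.univ.filter (fun i => ω i = j), w i) ≤ (15 / 16) * α)).card : ℝ)
      / (H : ℝ) ^ l ≤ Real.exp (-α / (512 * ζ)) := by
  have hH0 : (0 : ℝ) < (H : ℝ) ^ l := pow_pos (by exact_mod_cast hH) l
  set t : ℝ := 1 / (16 * ζ) with ht_def
  have ht : 0 ≤ t := by positivity
  rw [div_le_iff₀ hH0, Finset.card_filter]
  push_cast
  calc _ ≤ ∑ ω : Fin l → Fin H, Real.exp (t * (15 / 16 * α)) *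
          Real.exp (-(t * ∑ i ∈ Finset.univ.filter (fun i => ω i = j), w i)) := by
        refine Finset.sum_le_sum fun ω _ => ?_
        rw [← Real.exp_add]
        split_ifs with h
        · exact Real.one_le_exp (by linarith [mul_le_mul_of_nonneg_left h ht])
        · exact (Real.exp_pos _).le
    _ ≤ Real.exp (t * (15 / 16 * α)) *
          ((H : ℝ) ^ l * Real.exp (α * (-t + t ^ 2 * ζ / 2))) := by
        rw [← Finset.mul_sum]
        exact mul_le_mul_of_nonneg_left (sum_exp_neg_bin_weight_le hH ht w hw hsum j)
          (Real.exp_pos _).le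
    _ = Real.exp (-α / (512 * ζ)) * (H : ℝ) ^ l := by
        rw [mul_left_comm, ← Real.exp_add, mul_comm]
        congr 2
        rw [ht_def]
        field_simp
        ring
end

section
/- Let H ≥ 1 and l be natural numbers and let Δ > 2 be a real with l ≥ H·Δ. When the l balls are thrown independently and uniformly at random into the H bins, then for every fixed bin j, Pr[bin j contains at most 1 ball] ≤ exp(−(Δ−2)²/(2Δ)). -/
open scoped Classical

/-- The generating function of the number of balls in bin `j`. -/
lemma sum_pow_card_bin (H l : ℕ) (j : Fin H) (z : ℝ) :
    ∑ ω : Fin l → Fin H, z ^ (Finset.univ.filter (fun i => ω i = j)).card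
      = ((H : ℝ) - (1 - z)) ^ l := by
  have hsum : ∑ b : Fin H, (if b = j then z else 1) = (H : ℝ) - (1 - z) := by
    have hsplit : ∀ b : Fin H, (if b = j then z else 1) = 1 - (if b = j then 1 - z else 0) := by
      intro b
      split_ifs <;> ring
    simp [hsplit, Finset.sum_sub_distrib]
  rw [← hsum, Fintype.sum_pow]
  refine Finset.sum_congr rfl fun ω _ => ?_
  rw [Finset.prod_ite, Finset.prod_const, Finset.prod_const_one, mul_one]

/-- Markov's inequality for `z ^ X`, where `X` is the number of balls in bin `j`. -/
lemma card_few_balls_mul_le (H l : ℕ) (j : Fin H) {z : ℝ} (hz₀ : 0 ≤ z) (hz₁ : z ≤ 1) :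
    ((Finset.univ.filter (fun ω : Fin l → Fin H =>
        (Finset.univ.filter (fun i => ω i = j)).card ≤ 1)).card : ℝ) * z
      ≤ ((H : ℝ) - (1 - z)) ^ l := by
  rw [← sum_pow_card_bin, ← nsmul_eq_mul, ← Finset.sum_const]
  refine (Finset.sum_le_sum fun ω hω => ?_).trans
    (Finset.sum_le_sum_of_subset_of_nonneg (Finset.filter_subset _ _)
      fun ω _ _ => pow_nonneg hz₀ _)
  simpa using pow_le_pow_of_le_one hz₀ hz₁ (Finset.mem_filter.mp hω).2

lemma log_le_half_add_one_sub {x : ℝ} (hx : 2 ≤ x) : Real.log x ≤ x / 2 + 1 - 2 / x := by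
  have hlog : Real.log x = Real.log 2 + Real.log (x / 2) := by
    rw [← Real.log_mul (by norm_num) (by positivity)]
    congr 1
    ring
  have htwo := Real.log_le_sub_one_of_pos (show (0 : ℝ) < 2 by norm_num)
  have hhalf := Real.log_le_sub_one_of_pos (show 0 < x / 2 by positivity)
  have hdiv : 2 / x ≤ 1 := (div_le_one (by positivity)).mpr hx
  linarith

/-- Single-bin bound for balls-into-bins: with `l ≥ H·Δ` balls for `Δ > 2`, the
probability that a fixed bin `j` contains at most one ball is at most
`exp (-(Δ-2)² / (2Δ))`. The sample space is the set of functions `ω : Fin l → Fin H`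
with the uniform measure, so the probability of an event is its cardinality divided
by `H ^ l`. -/
theorem bin_few_balls (H l : ℕ) (hH : 1 ≤ H) (Δ : ℝ) (hΔ : 2 < Δ)
    (hl : (H : ℝ) * Δ ≤ l) (j : Fin H) :
    ((Finset.univ.filter (fun ω : Fin l → Fin H =>
        (Finset.univ.filter (fun i => ω i = j)).card ≤ 1)).card : ℝ)
      / (H : ℝ) ^ l ≤ Real.exp (-(Δ - 2) ^ 2 / (2 * Δ)) := by
  have hΔ₀ : 0 < Δ := by linarith
  have hH₀ : (0 : ℝ) < H := by exact_mod_cast hH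
  have hH₁ : (1 : ℝ) ≤ H := by exact_mod_cast hH
  have hz₀ : 0 < Δ⁻¹ := inv_pos.mpr hΔ₀
  have hz₁ : Δ⁻¹ ≤ 1 := inv_le_one_of_one_le₀ (by linarith)
  have hpow : (((H : ℝ) - (1 - Δ⁻¹)) / H) ^ l ≤ Real.exp (1 - Δ) := by
    have hbase : ((H : ℝ) - (1 - Δ⁻¹)) / H ≤ Real.exp (-((1 - Δ⁻¹) / H)) := by
      have h := Real.add_one_le_exp (-((1 - Δ⁻¹) / H))
      rw [sub_div, div_self hH₀.ne']
      linarith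
    refine (pow_le_pow_left₀ (div_nonneg (by linarith) hH₀.le) hbase l).trans ?_
    rw [← Real.exp_nat_mul, Real.exp_le_exp]
    have hmean : Δ ≤ l / H := (le_div_iff₀ hH₀).mpr (by linarith)
    calc (l : ℝ) * -((1 - Δ⁻¹) / H) = -((1 - Δ⁻¹) * (l / H)) := by ring
      _ ≤ -((1 - Δ⁻¹) * Δ) :=
        neg_le_neg (mul_le_mul_of_nonneg_left hmean (by linarith))
      _ = 1 - Δ := by
        field_simp
        ring
  have hmarkov := card_few_balls_mul_le H l j hz₀.le hz₁
  rw [← div_eq_mul_inv, div_le_iff₀ hΔ₀] at hmarkov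
  calc _ ≤ ((H : ℝ) - (1 - Δ⁻¹)) ^ l * Δ / (H : ℝ) ^ l := by gcongr
    _ = (((H : ℝ) - (1 - Δ⁻¹)) / H) ^ l * Δ := by
      rw [div_pow]
      ring
    _ ≤ Real.exp (1 - Δ) * Δ := by gcongr
    _ = Real.exp (1 - Δ + Real.log Δ) := by rw [Real.exp_add, Real.exp_log hΔ₀]
    _ ≤ _ := by
      rw [Real.exp_le_exp]
      have hexp : -(Δ - 2) ^ 2 / (2 * Δ) = 2 - Δ / 2 - 2 / Δ := by
        field_simp
        ring
      linarith [log_le_half_add_one_sub hΔ.le]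
end
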